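/- For all real numbers x > 0 and y > 0, one has x·log(x/y) − x + y ≥ (8/9)·(x − y)²/(x + y). -/

import Mathlib

open Set in
theorem rational_le_log {u : ℝ} (hu : 0 < u) :
    17 / 9 - 1 / 9 * u⁻¹ - 32 / 9 * (u + 1)⁻¹ ≤ Real.log u := by
  let h : ℝ → ℝ := fun t ↦ Real.log t - (17 / 9 - 1 / 9 * t⁻¹ - 32 / 9 * (t + 1)⁻¹)
  have hderiv : ∀ t, 0 < t →
      HasDerivAt h ((t - 1) * (3 * t - 1) ^ 2 / (9 * t ^ 2 * (t + 1) ^ 2)) t := by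
    intro t ht
    have ht' : t + 1 ≠ 0 := by positivity
    refine ((Real.hasDerivAt_log ht.ne').sub
      ((((hasDerivAt_inv ht.ne').const_mul (1 / 9)).const_sub (17 / 9)).sub
        ((((hasDerivAt_id' t).add_const 1).inv ht').const_mul (32 / 9)))).congr_deriv ?_
    field_simp
    ring
  have hone : h 1 = 0 := by norm_num [h]
  suffices h 1 ≤ h u from sub_nonneg.1 (hone ▸ this)
  rcases le_total u 1 with hu1 | hu1
  · have hanti : AntitoneOn h (Ioc 0 1) := by
      refine antitoneOn_of_hasDerivWithinAt_nonpos (convex_Ioc 0 1)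
        (fun t ht ↦ (hderiv t ht.1).continuousAt.continuousWithinAt)
        (fun t ht ↦ (hderiv t (interior_subset ht).1).hasDerivWithinAt) fun t ht ↦ ?_
      have ht1 : t - 1 ≤ 0 := sub_nonpos.2 (interior_subset ht).2
      exact div_nonpos_of_nonpos_of_nonneg
        (mul_nonpos_of_nonpos_of_nonneg ht1 (sq_nonneg _)) (by positivity)
    exact hanti ⟨hu, hu1⟩ ⟨one_pos, le_rfl⟩ hu1
  · have hmono : MonotoneOn h (Ici 1) := by
      refine monotoneOn_of_hasDerivWithinAt_nonneg (convex_Ici 1)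
        (fun t ht ↦ (hderiv t (one_pos.trans_le ht)).continuousAt.continuousWithinAt)
        (fun t ht ↦ (hderiv t (one_pos.trans_le (interior_subset ht))).hasDerivWithinAt)
        fun t ht ↦ ?_
      have ht1 : 0 ≤ t - 1 := sub_nonneg.2 (interior_subset ht)
      positivity
    exact hmono self_mem_Ici hu1 hu1

/-- For all positive reals `x` and `y`:
`x * log (x / y) - x + y ≥ (8/9) * (x - y)^2 / (x + y)`. -/
theorem relative_entropy_lower_bound (x y : ℝ) (hx : 0 < x) (hy : 0 < y) :
    x * Real.log (x / y) - x + y ≥ (8 / 9) * (x - y) ^ 2 / (x + y) := by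
  have hlog := mul_le_mul_of_nonneg_left (rational_le_log (div_pos hx hy)) hx.le
  have hrat : x * (17 / 9 - 1 / 9 * (x / y)⁻¹ - 32 / 9 * (x / y + 1)⁻¹) =
      (8 / 9) * (x - y) ^ 2 / (x + y) + x - y := by
    have hxy : x + y ≠ 0 := by positivity
    field_simp
    ring
  linarith
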